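/- (Operator norm bound on the Hessian of the congestion.) Let s ∈ {0,1}^m be a binary connected switching vector, let x = L_s^† d, and define the symmetric m × m matrix H(s) with entries H(s)_{e,e'} = 2 · s_e s_{e'} · w_e w_{e'} · (a_eᵀ x)(a_{e'}ᵀ x) · (a_eᵀ L_s^† a_{e'}). Then the operator norm of H(s) satisfies ‖H(s)‖_op ≤ 2 φ(s) ≤ 2 ‖d‖₂² / λ₂(L_s), where λ₂(L_s) denotes the second-smallest eigenvalue of L_s, i.e. the smallest eigenvalue of L_s restricted to the subspace orthogonal to the all-ones vector 1. -/

import Mathlib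

open Matrix MeasureTheory BigOperators

noncomputable section

/-- `A` is a signed incidence matrix: each row is `e_i - e_j` for some `i ≠ j`. -/
def isIncidence (n m : ℕ) (A : Matrix (Fin m) (Fin n) ℝ) : Prop :=
  ∀ e : Fin m, ∃ i j : Fin n, i ≠ j ∧
    A e = fun k => (if k = i then (1 : ℝ) else 0) - (if k = j then (1 : ℝ) else 0)

/-- The matrix `1 1ᵀ / n`, with all entries equal to `1/n`. -/
def onesMat (n : ℕ) : Matrix (Fin n) (Fin n) ℝ := fun _ _ => (1 : ℝ) / n

/-- The switched Laplacian `L_s = Aᵀ diag(w ∘ s) A`. -/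
def Lap (n m : ℕ) (A : Matrix (Fin m) (Fin n) ℝ) (w s : Fin m → ℝ) :
    Matrix (Fin n) (Fin n) ℝ :=
  Aᵀ * Matrix.diagonal (fun e => w e * s e) * A

/-- The Moore–Penrose pseudoinverse of a connected Laplacian:
`L† = (L + 1 1ᵀ/n)⁻¹ - 1 1ᵀ/n`. -/
def Lpinv (n m : ℕ) (A : Matrix (Fin m) (Fin n) ℝ) (w s : Fin m → ℝ) :
    Matrix (Fin n) (Fin n) ℝ :=
  (Lap n m A w s + onesMat n)⁻¹ - onesMat n

/-- Connectivity, encoded as: the kernel of the Laplacian is exactly `span(1)`. -/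
def kerIsOnes (n : ℕ) (L : Matrix (Fin n) (Fin n) ℝ) : Prop :=
  ∀ y : Fin n → ℝ, L.mulVec y = 0 ↔ ∃ c : ℝ, y = fun _ => c

/-- The relaxed congestion `φ(s) = dᵀ L_s† d`. -/
def phi (n m : ℕ) (A : Matrix (Fin m) (Fin n) ℝ) (w s : Fin m → ℝ) (d : Fin n → ℝ) : ℝ :=
  d ⬝ᵥ (Lpinv n m A w s).mulVec d

/-- The Hessian of the congestion, with entries
`H_{e,e'} = 2 s_e s_{e'} w_e w_{e'} (a_eᵀ x)(a_{e'}ᵀ x)(a_eᵀ L_s† a_{e'})`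
where `x = L_s† d`. -/
def congHess (n m : ℕ) (A : Matrix (Fin m) (Fin n) ℝ) (w s : Fin m → ℝ)
    (d : Fin n → ℝ) : Matrix (Fin m) (Fin m) ℝ :=
  Matrix.of fun e e' =>
    2 * s e * s e' * w e * w e' *
      (A e ⬝ᵥ (Lpinv n m A w s).mulVec d) * (A e' ⬝ᵥ (Lpinv n m A w s).mulVec d) *
      (A e ⬝ᵥ (Lpinv n m A w s).mulVec (A e'))

lemma lap_mulVec (n m : ℕ) (A : Matrix (Fin m) (Fin n) ℝ) (w s : Fin m → ℝ) (y : Fin n → ℝ) :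
    (Lap n m A w s).mulVec y = Aᵀ *ᵥ fun e => w e * s e * (A e ⬝ᵥ y) := by
  rw [Lap, ← mulVec_mulVec, ← mulVec_mulVec]
  congr 1
  ext e
  rw [mulVec_diagonal]
  rfl

lemma dotProduct_lap_mulVec (n m : ℕ) (A : Matrix (Fin m) (Fin n) ℝ) (w s : Fin m → ℝ)
    (y z : Fin n → ℝ) :
    y ⬝ᵥ (Lap n m A w s).mulVec z = ∑ e, w e * s e * (A e ⬝ᵥ y) * (A e ⬝ᵥ z) := by
  rw [lap_mulVec, dotProduct_mulVec, vecMul_transpose]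
  refine Finset.sum_congr rfl fun e _ => ?_
  change (A e ⬝ᵥ y) * _ = _
  ring

lemma onesMat_mulVec (n : ℕ) (y : Fin n → ℝ) :
    (onesMat n).mulVec y = fun _ => (∑ i, y i) / n := by
  ext i
  simp only [onesMat, mulVec, dotProduct]
  rw [← Finset.mul_sum]
  ring

lemma isIncidence.sum_row {n m : ℕ} {A : Matrix (Fin m) (Fin n) ℝ} (hA : isIncidence n m A)
    (e : Fin m) : ∑ k, A e k = 0 := by
  obtain ⟨i, j, -, h⟩ := hA e
  simp [h]

lemma isIncidence.sum_transpose_mulVec {n m : ℕ} {A : Matrix (Fin m) (Fin n) ℝ}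
    (hA : isIncidence n m A) (v : Fin m → ℝ) : ∑ k, (Aᵀ *ᵥ v) k = 0 := by
  simp only [mulVec, dotProduct, transpose_apply]
  rw [Finset.sum_comm]
  simp [← Finset.sum_mul, hA.sum_row]

lemma isUnit_lap_add_onesMat {n m : ℕ} (hn : n ≠ 0) {A : Matrix (Fin m) (Fin n) ℝ}
    (hA : isIncidence n m A) {w s : Fin m → ℝ} (hconn : kerIsOnes n (Lap n m A w s)) :
    IsUnit (Lap n m A w s + onesMat n) := by
  have hn' : (n : ℝ) ≠ 0 := Nat.cast_ne_zero.mpr hn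
  rw [← mulVec_injective_iff_isUnit]
  refine (injective_iff_map_eq_zero (Lap n m A w s + onesMat n).mulVecLin).mpr fun y hy => ?_
  rw [mulVecLin_apply, add_mulVec, onesMat_mulVec, lap_mulVec] at hy
  have hsum : ∑ i, y i = 0 := by
    have h := congrArg (fun z : Fin n → ℝ => ∑ k, z k) hy
    simp only [Pi.add_apply, Finset.sum_add_distrib, hA.sum_transpose_mulVec, Pi.zero_apply,
      Finset.sum_const_zero, zero_add, Finset.sum_const, Finset.card_univ, Fintype.card_fin,
      nsmul_eq_mul] at h
    field_simp at h
    exact h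
  rw [← lap_mulVec, hsum] at hy
  obtain ⟨c, rfl⟩ := (hconn y).mp (by simpa [funext_iff] using hy)
  have hc : c = 0 := by simpa [hn] using hsum
  ext
  simp [hc]

/-- On the hyperplane orthogonal to `1`, the pseudoinverse inverts the Laplacian. -/
lemma lap_mulVec_lpinv_mulVec {n m : ℕ} (hn : n ≠ 0) {A : Matrix (Fin m) (Fin n) ℝ}
    (hA : isIncidence n m A) {w s : Fin m → ℝ} (hconn : kerIsOnes n (Lap n m A w s))
    {b : Fin n → ℝ} (hb : ∑ i, b i = 0) :
    ∑ i, (Lpinv n m A w s).mulVec b i = 0 ∧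
      (Lap n m A w s).mulVec ((Lpinv n m A w s).mulVec b) = b := by
  have hn' : (n : ℝ) ≠ 0 := Nat.cast_ne_zero.mpr hn
  have hdet := (isUnit_iff_isUnit_det _).mp (isUnit_lap_add_onesMat hn hA hconn)
  have hP : (Lpinv n m A w s).mulVec b = (Lap n m A w s + onesMat n)⁻¹.mulVec b := by
    rw [Lpinv, sub_mulVec, onesMat_mulVec, hb]
    ext
    simp
  have hM : (Lap n m A w s + onesMat n).mulVec ((Lpinv n m A w s).mulVec b) = b := by
    rw [hP, mulVec_mulVec, mul_nonsing_inv _ hdet, one_mulVec]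
  generalize (Lpinv n m A w s).mulVec b = y at hM
  rw [add_mulVec, onesMat_mulVec] at hM
  have hsum : ∑ i, y i = 0 := by
    have h := congrArg (fun z : Fin n → ℝ => ∑ k, z k) hM
    simp only [lap_mulVec, Pi.add_apply, Finset.sum_add_distrib, hA.sum_transpose_mulVec, hb,
      zero_add, Finset.sum_const, Finset.card_univ, Fintype.card_fin, nsmul_eq_mul] at h
    field_simp at h
    exact h
  refine ⟨hsum, ?_⟩
  rw [hsum] at hM
  simpa [funext_iff] using hM

lemma congHess_mulVec (n m : ℕ) (A : Matrix (Fin m) (Fin n) ℝ) (w s : Fin m → ℝ)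
    (d : Fin n → ℝ) (v : Fin m → ℝ) (e : Fin m) :
    (congHess n m A w s d).mulVec v e =
      2 * (w e * s e) * (A e ⬝ᵥ (Lpinv n m A w s).mulVec d) *
        (A e ⬝ᵥ (Lpinv n m A w s).mulVec
          (Aᵀ *ᵥ fun f => w f * s f * (A f ⬝ᵥ (Lpinv n m A w s).mulVec d) * v f)) := by
  rw [mulVec_eq_sum (M := Aᵀ), mulVec_sum, dotProduct_sum, Finset.mul_sum]
  change ∑ f, congHess n m A w s d e f * v f = _
  refine Finset.sum_congr rfl fun f _ => ?_
  rw [op_smul_eq_smul, mulVec_smul, dotProduct_smul, smul_eq_mul, transpose_transpose, congHess,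
    of_apply]
  ring

lemma norm_toEuclideanCLM_le_of_sum_sq_le {ι : Type*} [Fintype ι] [DecidableEq ι]
    (M : Matrix ι ι ℝ) {c : ℝ} (hc : 0 ≤ c)
    (h : ∀ v : ι → ℝ, ∑ i, (M.mulVec v i) ^ 2 ≤ c ^ 2 * ∑ i, v i ^ 2) :
    ‖Matrix.toEuclideanCLM (𝕜 := ℝ) M‖ ≤ c := by
  refine ContinuousLinearMap.opNorm_le_bound _ hc fun v => ?_
  refine le_of_sq_le_sq ?_ (by positivity)
  rw [mul_pow, EuclideanSpace.real_norm_sq_eq, EuclideanSpace.real_norm_sq_eq]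
  exact h v.ofLp

lemma sum_mul_mul_sq_le {ι : Type*} [Fintype ι] {q a b : ι → ℝ} (hq : ∀ i, 0 ≤ q i) :
    (∑ i, q i * a i * b i) ^ 2 ≤ (∑ i, q i * a i ^ 2) * ∑ i, q i * b i ^ 2 :=
  Finset.sum_sq_le_sum_mul_sum_of_sq_le_mul _
    (fun i _ => mul_nonneg (hq i) (sq_nonneg _)) (fun i _ => mul_nonneg (hq i) (sq_nonneg _))
    fun i _ => le_of_eq (by ring)

lemma sum_mul_le_sum_mul_sum {ι : Type*} [Fintype ι] {f g : ι → ℝ} (hf : ∀ i, 0 ≤ f i)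
    (hg : ∀ i, 0 ≤ g i) : ∑ i, f i * g i ≤ (∑ i, f i) * ∑ i, g i := by
  rw [Finset.sum_mul]
  exact Finset.sum_le_sum fun i _ => mul_le_mul_of_nonneg_left
    (Finset.single_le_sum (fun j _ => hg j) (Finset.mem_univ i)) (hf i)

/-- The quadratic form of a connected Laplacian is bounded below on the hyperplane `1⊥`. -/
lemma exists_pos_mul_sum_sq_le {n m : ℕ} (hn : 2 ≤ n) {A : Matrix (Fin m) (Fin n) ℝ}
    {w s : Fin m → ℝ} (hq : ∀ e, 0 ≤ w e * s e) (hconn : kerIsOnes n (Lap n m A w s)) :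
    ∃ c : ℝ, 0 < c ∧ ∀ y : Fin n → ℝ, ∑ i, y i = 0 →
      c * ∑ i, y i ^ 2 ≤ y ⬝ᵥ (Lap n m A w s).mulVec y := by
  let Q : EuclideanSpace ℝ (Fin n) → ℝ := fun y => y.ofLp ⬝ᵥ (Lap n m A w s).mulVec y.ofLp
  let K : Set (EuclideanSpace ℝ (Fin n)) := Metric.sphere 0 1 ∩ {y | ∑ i, y i = 0}
  have hQpos : ∀ y ∈ K, 0 < Q y := by
    rintro y ⟨hy1, hy0⟩
    have hQ : Q y = ∑ e, w e * s e * (A e ⬝ᵥ y.ofLp) * (A e ⬝ᵥ y.ofLp) :=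
      dotProduct_lap_mulVec ..
    have hnn : ∀ e, 0 ≤ w e * s e * (A e ⬝ᵥ y.ofLp) * (A e ⬝ᵥ y.ofLp) := fun e => by
      rw [mul_assoc]
      exact mul_nonneg (hq e) (mul_self_nonneg _)
    refine (hQ ▸ Finset.sum_nonneg fun e _ => hnn e).lt_of_ne' fun h0 => ?_
    rw [hQ, Finset.sum_eq_zero_iff_of_nonneg fun e _ => hnn e] at h0
    have hL : (Lap n m A w s).mulVec y.ofLp = 0 := by
      rw [lap_mulVec]
      refine (congrArg (Aᵀ *ᵥ ·) (funext fun e => ?_)).trans (mulVec_zero Aᵀ)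
      rcases mul_eq_zero.mp (h0 e (Finset.mem_univ e)) with h | h
      · exact h
      · simp [h]
    obtain ⟨c, hc⟩ := (hconn _).mp hL
    have hy0' : ∑ i, y.ofLp i = 0 := hy0
    have hn0 : n ≠ 0 := by omega
    have hc0 : c = 0 := by simpa [hc, hn0] using hy0'
    have hyz : y = 0 := by
      ext i
      simp [hc, hc0]
    simp [hyz] at hy1
  have hK : IsCompact K := (isCompact_sphere _ _).inter_right
    (isClosed_eq (by fun_prop) continuous_const)
  have hQc : Continuous Q := by
    simp only [Q, mulVec, dotProduct]
    fun_prop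
  obtain ⟨c, hc, hcK⟩ : ∃ c : ℝ, 0 < c ∧ ∀ y ∈ K, c ≤ Q y := by
    rcases K.eq_empty_or_nonempty with hE | hE
    · exact ⟨1, one_pos, by simp [hE]⟩
    · obtain ⟨z, hz, hmin⟩ := hK.exists_isMinOn hE hQc.continuousOn
      exact ⟨Q z, hQpos z hz, fun y hy => hmin hy⟩
  refine ⟨c, hc, fun y hy => ?_⟩
  by_cases hy0 : y = 0
  · simp [hy0]
  have hv : WithLp.toLp 2 y ≠ 0 := by simpa using hy0
  have hr : 0 < ‖WithLp.toLp 2 y‖ := norm_pos_iff.mpr hv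
  have hsq : ∑ i, y i ^ 2 = ‖WithLp.toLp 2 y‖ ^ 2 :=
    (EuclideanSpace.real_norm_sq_eq (WithLp.toLp 2 y)).symm
  have h := hcK (‖WithLp.toLp 2 y‖⁻¹ • WithLp.toLp 2 y)
    ⟨by simp [norm_smul, hr.ne'], by simp [← Finset.mul_sum, hy]⟩
  simp only [Q, WithLp.ofLp_smul, mulVec_smul, dotProduct_smul, smul_dotProduct,
    smul_eq_mul] at h
  rw [hsq]
  generalize ‖WithLp.toLp 2 y‖ = r at *
  field_simp at h
  linarith

/-- Operator norm bound on the Hessian of the congestion.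
For binary connected `s`, the Hessian `H(s)` satisfies
`‖H(s)‖_op ≤ 2 φ(s) ≤ 2 ‖d‖₂² / λ₂(L_s)`, where `λ₂(L_s)` is the smallest
eigenvalue of the quadratic form of `L_s` restricted to `1⊥`, encoded as the
greatest `c` with `c‖y‖² ≤ yᵀ L_s y` for all `y ⊥ 1`. -/
theorem congHess_opNorm_bound
    (n m : ℕ) (hn : 2 ≤ n) (hm : 1 ≤ m)
    (A : Matrix (Fin m) (Fin n) ℝ) (hA : isIncidence n m A)
    (w : Fin m → ℝ) (hw : ∀ e, 0 < w e)
    (d : Fin n → ℝ) (hd : ∑ i, d i = 0)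
    (s : Fin m → ℝ) (hbin : ∀ f, s f = 0 ∨ s f = 1)
    (hconn : kerIsOnes n (Lap n m A w s))
    (lam2 : ℝ)
    (hlam : IsGreatest {c : ℝ | ∀ y : Fin n → ℝ, (∑ i, y i = 0) →
      c * (∑ i, (y i) ^ 2) ≤ y ⬝ᵥ (Lap n m A w s).mulVec y} lam2) :
    ‖Matrix.toEuclideanCLM (𝕜 := ℝ) (congHess n m A w s d)‖ ≤ 2 * phi n m A w s d ∧
    2 * phi n m A w s d ≤ 2 * (∑ i, (d i) ^ 2) / lam2 := by
  have hn0 : n ≠ 0 := by omega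
  have hq : ∀ e, 0 ≤ w e * s e := fun e =>
    mul_nonneg (hw e).le (by rcases hbin e with h | h <;> simp [h])
  obtain ⟨hx0, hLx⟩ := lap_mulVec_lpinv_mulVec hn0 hA hconn hd
  have hphi : phi n m A w s d = (Lpinv n m A w s).mulVec d ⬝ᵥ d := dotProduct_comm _ _
  have hHv := congHess_mulVec n m A w s d
  generalize (Lpinv n m A w s).mulVec d = x at hx0 hLx hphi hHv
  have hphi_lap : phi n m A w s d = x ⬝ᵥ (Lap n m A w s).mulVec x := by rw [hLx, hphi]
  have hphi_sum : phi n m A w s d = ∑ e, w e * s e * (A e ⬝ᵥ x) ^ 2 := by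
    rw [hphi_lap, dotProduct_lap_mulVec]
    exact Finset.sum_congr rfl fun e _ => by ring
  have hnn : ∀ (z : Fin n → ℝ) (e), 0 ≤ w e * s e * (A e ⬝ᵥ z) ^ 2 := fun z e =>
    mul_nonneg (hq e) (sq_nonneg _)
  have hphi_nonneg : 0 ≤ phi n m A w s d := hphi_sum ▸ Finset.sum_nonneg fun e _ => hnn x e
  constructor
  · refine norm_toEuclideanCLM_le_of_sum_sq_le _ (by positivity) fun v => ?_
    simp only [hHv]
    have hu := hA.sum_transpose_mulVec fun f => w f * s f * (A f ⬝ᵥ x) * v f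
    obtain ⟨-, hLy⟩ := lap_mulVec_lpinv_mulVec hn0 hA hconn hu
    generalize (Lpinv n m A w s).mulVec (Aᵀ *ᵥ fun f => w f * s f * (A f ⬝ᵥ x) * v f) = y at hLy ⊢
    have hE : ∑ e, w e * s e * (A e ⬝ᵥ y) ^ 2 =
        ∑ e, w e * s e * (A e ⬝ᵥ y) * ((A e ⬝ᵥ x) * v e) := by
      have h := dotProduct_lap_mulVec n m A w s y y
      rw [hLy, dotProduct_mulVec, vecMul_transpose] at h
      calc _ = ∑ e, w e * s e * (A e ⬝ᵥ y) * (A e ⬝ᵥ y) :=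
            Finset.sum_congr rfl fun e _ => by ring
        _ = _ := by
          rw [← h]
          refine Finset.sum_congr rfl fun e _ => ?_
          change (A e ⬝ᵥ y) * _ = _
          ring
    have hE_nonneg : 0 ≤ ∑ e, w e * s e * (A e ⬝ᵥ y) ^ 2 := Finset.sum_nonneg fun e _ => hnn y e
    have hCS := sum_mul_mul_sq_le (a := fun e => A e ⬝ᵥ y) (b := fun e => (A e ⬝ᵥ x) * v e) hq
    rw [← hE] at hCS
    have hB : ∑ e, w e * s e * ((A e ⬝ᵥ x) * v e) ^ 2 ≤
        phi n m A w s d * ∑ e, v e ^ 2 := by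
      rw [hphi_sum]
      refine le_trans (le_of_eq ?_) (sum_mul_le_sum_mul_sum (hnn x) fun e => sq_nonneg (v e))
      exact Finset.sum_congr rfl fun e _ => by ring
    have hE_le : ∑ e, w e * s e * (A e ⬝ᵥ y) ^ 2 ≤ phi n m A w s d * ∑ e, v e ^ 2 := by
      rcases hE_nonneg.eq_or_lt with h0 | h0
      · rw [← h0]
        positivity
      · exact (le_of_mul_le_mul_left (by rwa [← sq]) h0).trans hB
    calc _ = 4 * ∑ e, (w e * s e * (A e ⬝ᵥ x) ^ 2) * (w e * s e * (A e ⬝ᵥ y) ^ 2) := by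
          rw [Finset.mul_sum]
          exact Finset.sum_congr rfl fun e _ => by ring
      _ ≤ 4 * (phi n m A w s d * (phi n m A w s d * ∑ e, v e ^ 2)) := by
          refine mul_le_mul_of_nonneg_left ?_ (by norm_num)
          refine (sum_mul_le_sum_mul_sum (hnn x) (hnn y)).trans ?_
          rw [← hphi_sum]
          exact mul_le_mul_of_nonneg_left hE_le hphi_nonneg
      _ = _ := by ring
  · obtain ⟨c, hc, hcL⟩ := exists_pos_mul_sum_sq_le hn hq hconn
    have hlam_pos : 0 < lam2 := hc.trans_le (hlam.2 hcL)
    have hxx := hlam.1 x hx0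
    rw [← hphi_lap] at hxx
    have hCS : phi n m A w s d ^ 2 ≤ (∑ i, x i ^ 2) * ∑ i, d i ^ 2 :=
      hphi ▸ Finset.sum_mul_sq_le_sq_mul_sq Finset.univ x d
    have hd2 : 0 ≤ ∑ i, d i ^ 2 := Finset.sum_nonneg fun i _ => sq_nonneg _
    rw [le_div_iff₀ hlam_pos]
    rcases hphi_nonneg.eq_or_lt with h0 | h0
    · rw [← h0]
      linarith
    · have h1 : phi n m A w s d * (phi n m A w s d * lam2) ≤
          phi n m A w s d * ∑ i, d i ^ 2 := by
        calc _ = lam2 * phi n m A w s d ^ 2 := by ring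
          _ ≤ lam2 * ((∑ i, x i ^ 2) * ∑ i, d i ^ 2) := by gcongr
          _ = (lam2 * ∑ i, x i ^ 2) * ∑ i, d i ^ 2 := by ring
          _ ≤ _ := by gcongr
      linarith [le_of_mul_le_mul_left h1 h0]
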